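/- (Fully adaptive composition for Gaussian queries; concrete form of Theorem 1.) Let T be a natural number, μ₀ > 0 a real number, and for each i ∈ {1,…,T} let f_i : ℝ^{i-1} → ℝ be a measurable function (f₁ a constant), representing the adaptively chosen query budget at round i as a function of the previous responses. Assume the budget constraint holds along every trajectory: for all w ∈ ℝ^T, Σ_{i=1}^T f_i(w₁,…,w_{i-1})² ≤ μ₀². For b ∈ ℝ, let P_b be the probability measure on ℝ^T of the adaptively generated transcript, i.e., the measure obtained by iterated composition of the Markov kernels κ_i^b(w₁,…,w_{i-1}) = N(b·f_i(w₁,…,w_{i-1}), 1): under P_b, the conditional distribution of the i-th coordinate given the first i-1 coordinates equal (w₁,…,w_{i-1}) is N(b·f_i(w₁,…,w_{i-1}), 1). Then there exists a single Markov kernel κ from ℝ to ℝ^T, not depending on b, such that for every b ∈ ℝ, P_b equals the composition of N(b·μ₀, 1) with κ. -/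

import Mathlib

open Matrix MeasureTheory ProbabilityTheory

/-- The first `n` responses (`n ≤ T`) of the adaptive transcript: given the bit-dependent
scaling `b`, adaptively chosen budgets `f i` (a function of the previous `i` responses), and
a vector `z` of noise values, the `i`-th response is `w i = b * f i (w₁, …, wᵢ₋₁) + z i`. -/
noncomputable def transcriptPrefix (T : ℕ) (b : ℝ)
    (f : (i : Fin T) → (Fin i → ℝ) → ℝ) (z : Fin T → ℝ) :
    (n : ℕ) → n ≤ T → (Fin n → ℝ)
  | 0, _ => Fin.elim0
  | n + 1, h =>
    Fin.snoc (transcriptPrefix T b f z n (Nat.le_of_succ_le h))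
      (b * f ⟨n, h⟩ (transcriptPrefix T b f z n (Nat.le_of_succ_le h)) + z ⟨n, h⟩)

/-- The law `P_b` on `ℝ^T` of the adaptively generated transcript: the iterated composition
of the Markov kernels `κᵢᵇ (w₁, …, wᵢ₋₁) = N(b * f i (w₁, …, wᵢ₋₁), 1)`, i.e., the law of
the process `w i = b * f i (w₁, …, wᵢ₋₁) + z i` driven by i.i.d. standard Gaussian noise
`z : ℝ^T`, so that under `P_b` the conditional distribution of the `i`-th coordinate given
the first `i - 1` coordinates `(w₁, …, wᵢ₋₁)` is `N(b * f i (w₁, …, wᵢ₋₁), 1)`. -/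
noncomputable def adaptiveTranscriptLaw (T : ℕ) (b : ℝ)
    (f : (i : Fin T) → (Fin i → ℝ) → ℝ) : Measure (Fin T → ℝ) :=
  (Measure.pi fun _ : Fin T => gaussianReal 0 1).map
    fun z => transcriptPrefix T b f z T le_rfl

/-- The unspent part of the budget `μ₀` after a transcript `w`, in the sum-of-squares sense. -/
noncomputable def remainingBudget (T : ℕ) (μ₀ : ℝ) (f : (i : Fin T) → (Fin i → ℝ) → ℝ)
    (w : Fin T → ℝ) : ℝ :=
  √(μ₀ ^ 2 - ∑ i : Fin T, f i (fun j => w (Fin.castLE i.isLt.le j)) ^ 2)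

lemma measurable_remainingBudget (T : ℕ) (μ₀ : ℝ) (f : (i : Fin T) → (Fin i → ℝ) → ℝ)
    (hf : ∀ i, Measurable (f i)) : Measurable (remainingBudget T μ₀ f) := by
  unfold remainingBudget
  refine (measurable_const.sub (Finset.measurable_fun_sum _ fun i _ => ?_)).sqrt
  exact ((hf i).comp (measurable_pi_lambda _ fun j => measurable_pi_apply _)).pow_const 2

lemma map_prod_eq_map_prodMap {α β γ : Type*} [MeasurableSpace α] [MeasurableSpace β]
    [MeasurableSpace γ] (μ : Measure α) (ν : Measure β) [SFinite μ] [SFinite ν] {F : α → γ}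
    (hF : Measurable F) : (μ.map F).prod ν = (μ.prod ν).map (Prod.map F id) := by
  simpa using Measure.map_prod_map μ ν hF measurable_id

lemma measurable_fin_snoc (n : ℕ) :
    Measurable fun p : (Fin n → ℝ) × ℝ => (Fin.snoc p.1 p.2 : Fin (n + 1) → ℝ) := by
  refine measurable_pi_lambda _ fun i => ?_
  induction i using Fin.lastCases with
  | last => simpa using measurable_snd
  | cast j => simpa [Function.comp_def] using (measurable_pi_apply j).comp measurable_fst

lemma measurePreserving_fin_snoc (n : ℕ) (ν : Measure ℝ) [SigmaFinite ν] :
    MeasurePreserving (fun p : (Fin n → ℝ) × ℝ => (Fin.snoc p.1 p.2 : Fin (n + 1) → ℝ))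
      ((Measure.pi fun _ => ν).prod ν) (Measure.pi fun _ => ν) := by
  have h := (measurePreserving_piFinSuccAbove (fun _ : Fin (n + 1) => ν) (Fin.last n)).symm
  have h' := h.comp (Measure.measurePreserving_swap (μ := Measure.pi fun _ : Fin n => ν) (ν := ν))
  convert h' using 1
  ext p : 1
  exact (Fin.insertNth_last' p.2 p.1).symm

lemma transcriptPrefix_succ (T : ℕ) (b : ℝ) (f : (i : Fin (T + 1)) → (Fin i → ℝ) → ℝ)
    (z : Fin (T + 1) → ℝ) (n : ℕ) (h : n ≤ T + 1) (h' : n ≤ T) :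
    transcriptPrefix (T + 1) b f z n h =
      transcriptPrefix T b (fun i => f i.castSucc) (fun i => z i.castSucc) n h' := by
  induction n with
  | zero => rfl
  | succ n ih =>
    simp only [transcriptPrefix]
    rw [ih _ (Nat.le_of_succ_le h')]
    rfl

lemma measurable_transcriptPrefix (T : ℕ) (b : ℝ) (f : (i : Fin T) → (Fin i → ℝ) → ℝ)
    (hf : ∀ i, Measurable (f i)) (n : ℕ) (h : n ≤ T) :
    Measurable fun z => transcriptPrefix T b f z n h := by
  induction n with
  | zero => exact measurable_const
  | succ n ih =>
    have ih' := ih (Nat.le_of_succ_le h)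
    exact (measurable_fin_snoc n).comp <| ih'.prodMk <|
      (measurable_const.mul ((hf ⟨n, h⟩).comp ih')).add (measurable_pi_apply _)

lemma isProbabilityMeasure_adaptiveTranscriptLaw (T : ℕ) (b : ℝ)
    (f : (i : Fin T) → (Fin i → ℝ) → ℝ) (hf : ∀ i, Measurable (f i)) :
    IsProbabilityMeasure (adaptiveTranscriptLaw T b f) :=
  Measure.isProbabilityMeasure_map (measurable_transcriptPrefix T b f hf T le_rfl).aemeasurable

lemma measurable_snoc_response (T : ℕ) (b : ℝ) (a : (Fin T → ℝ) → ℝ) (ha : Measurable a) :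
    Measurable fun p : (Fin T → ℝ) × ℝ =>
      (Fin.snoc p.1 (b * a p.1 + p.2) : Fin (T + 1) → ℝ) :=
  (measurable_fin_snoc T).comp (f := fun p : (Fin T → ℝ) × ℝ => (p.1, b * a p.1 + p.2))
    (by fun_prop)

lemma adaptiveTranscriptLaw_succ (T : ℕ) (b : ℝ) (f : (i : Fin (T + 1)) → (Fin i → ℝ) → ℝ)
    (hf : ∀ i, Measurable (f i)) :
    adaptiveTranscriptLaw (T + 1) b f =
      ((adaptiveTranscriptLaw T b fun i => f i.castSucc).prod (gaussianReal 0 1)).map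
        fun p => Fin.snoc p.1 (b * f (Fin.last T) p.1 + p.2) := by
  have hm := measurable_transcriptPrefix T b (fun i => f i.castSucc) (fun i => hf _) T le_rfl
  conv_rhs => rw [adaptiveTranscriptLaw, map_prod_eq_map_prodMap _ _ hm,
    Measure.map_map (measurable_snoc_response T b _ (hf (Fin.last T))) (hm.prodMap measurable_id)]
  rw [adaptiveTranscriptLaw, ← (measurePreserving_fin_snoc T (gaussianReal 0 1)).map_eq,
    Measure.map_map (measurable_transcriptPrefix _ b f hf _ le_rfl) (measurable_fin_snoc T)]
  congr 1
  ext p : 1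
  simp only [Function.comp_apply, transcriptPrefix]
  rw [transcriptPrefix_succ _ _ _ _ _ _ le_rfl]
  simp only [Fin.snoc_castSucc]
  congr 2
  exact Fin.snoc_last (α := fun _ => ℝ) _ _

/-- Orthogonal invariance of the standard Gaussian measure on the plane. -/
lemma map_gaussianReal_prod_orthogonal (c s : ℝ) (h : c ^ 2 + s ^ 2 = 1) :
    ((gaussianReal 0 1).prod (gaussianReal 0 1)).map
      (fun p : ℝ × ℝ => (c * p.1 + s * p.2, s * p.1 - c * p.2)) =
      (gaussianReal 0 1).prod (gaussianReal 0 1) := by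
  obtain ⟨θ, hs, hc⟩ : ∃ θ : ℝ, s = Real.cos θ ∧ c = Real.sin θ := by
    have hn : ‖(⟨s, c⟩ : ℂ)‖ = 1 := by
      rw [Complex.norm_def, Complex.normSq_mk, Real.sqrt_eq_one]
      linarith
    refine ⟨Complex.arg ⟨s, c⟩, ?_, ?_⟩
    · have := Complex.norm_mul_cos_arg ⟨s, c⟩
      rw [hn] at this
      simpa using this.symm
    · have := Complex.norm_mul_sin_arg ⟨s, c⟩
      rw [hn] at this
      simpa using this.symm
  have hrot := IsGaussian.map_rotation_eq_self_of_forall_strongDual_eq_zero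
    (μ := gaussianReal 0 1) (fun L => by
      have hL : ∀ x : ℝ, L x = x * L 1 := fun x => by
        simpa using L.map_smul x (1 : ℝ)
      rw [integral_congr_ae (ae_of_all _ hL), integral_mul_const, integral_id_gaussianReal,
        zero_mul]) θ
  conv_lhs => rw [← Measure.prod_swap, Measure.map_map (by fun_prop) measurable_swap]
  conv_rhs => rw [← hrot]
  congr 1
  ext p
  · simp [ContinuousLinearMap.rotation_apply, hs, hc]; ring
  · simp [ContinuousLinearMap.rotation_apply, hs, hc]; ring

/-- A measurable family of maps preserving a product measure `ν ⊗ τ`, applied fibrewise. -/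
lemma measurePreserving_fibrewise {α β γ : Type*} [MeasurableSpace α] [MeasurableSpace β]
    [MeasurableSpace γ] (μ : Measure α) (ν : Measure β) (τ : Measure γ) [SFinite μ] [SFinite ν]
    [SFinite τ] (R : α → β × γ → β × γ) (hR : Measurable (Function.uncurry R))
    (h : ∀ a, (ν.prod τ).map (R a) = ν.prod τ) :
    MeasurePreserving
      (fun q : (α × β) × γ =>
        ((q.1.1, (R q.1.1 (q.1.2, q.2)).1), (R q.1.1 (q.1.2, q.2)).2))
      ((μ.prod ν).prod τ) ((μ.prod ν).prod τ) := by
  have h₁ := measurePreserving_prodAssoc μ ν τ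
  have h₂ := (MeasurePreserving.id μ).skew_product hR (ae_of_all _ h)
  exact (h₁.symm.comp h₂).comp h₁

/-- One round of simulation: from the transcript `w` so far and a Gaussian `x` carrying the
remaining budget `m w`, produce the next response and a Gaussian carrying what is left of the
budget after spending `a w`, by rotating `x` against the fresh noise. -/
noncomputable def simulationStep (T : ℕ) (m a : (Fin T → ℝ) → ℝ)
    (p : ((Fin T → ℝ) × ℝ) × ℝ) : (Fin (T + 1) → ℝ) × ℝ :=
  (Fin.snoc p.1.1 (a p.1.1 / m p.1.1 * p.1.2 + √(1 - (a p.1.1 / m p.1.1) ^ 2) * p.2),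
    √(1 - (a p.1.1 / m p.1.1) ^ 2) * p.1.2 - a p.1.1 / m p.1.1 * p.2)

lemma measurable_simulationStep (T : ℕ) (m a : (Fin T → ℝ) → ℝ) (hm : Measurable m)
    (ha : Measurable a) : Measurable (simulationStep T m a) := by
  refine Measurable.prodMk ?_ (by fun_prop)
  exact (measurable_fin_snoc T).comp (f := fun p : ((Fin T → ℝ) × ℝ) × ℝ =>
    (p.1.1, a p.1.1 / m p.1.1 * p.1.2 + √(1 - (a p.1.1 / m p.1.1) ^ 2) * p.2)) (by fun_prop)

lemma map_simulationStep (T : ℕ) (L : Measure (Fin T → ℝ)) [IsProbabilityMeasure L]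
    (m a : (Fin T → ℝ) → ℝ) (m' : (Fin (T + 1) → ℝ) → ℝ) (b : ℝ)
    (hm : Measurable m) (ha : Measurable a) (hm' : Measurable m')
    (hm0 : ∀ w, 0 ≤ m w) (ham : ∀ w, a w ^ 2 ≤ m w ^ 2)
    (hmm' : ∀ w y, m' (Fin.snoc w y) = √(m w ^ 2 - a w ^ 2)) :
    (((L.prod (gaussianReal 0 1)).map fun p => (p.1, b * m p.1 + p.2)).prod
        (gaussianReal 0 1)).map (simulationStep T m a) =
      (((L.prod (gaussianReal 0 1)).map fun p =>
          (Fin.snoc p.1 (b * a p.1 + p.2) : Fin (T + 1) → ℝ)).prod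
        (gaussianReal 0 1)).map fun p => (p.1, b * m' p.1 + p.2) := by
  have hcm : ∀ w, a w / m w * m w = a w := fun w => by
    rcases (hm0 w).eq_or_lt' with h | h
    · have := ham w
      rw [h] at this
      have : a w = 0 := by nlinarith
      simp [this]
    · field_simp
  have hc1 : ∀ w, (a w / m w) ^ 2 ≤ 1 := fun w => by
    rw [div_pow]
    exact div_le_one_of_le₀ (ham w) (sq_nonneg _)
  have hsm : ∀ w, √(1 - (a w / m w) ^ 2) * m w = √(m w ^ 2 - a w ^ 2) := fun w => by
    have : m w ^ 2 - a w ^ 2 = (1 - (a w / m w) ^ 2) * m w ^ 2 := by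
      rw [sub_mul, one_mul, ← mul_pow, hcm]
    rw [this, Real.sqrt_mul (by linarith [hc1 w]), Real.sqrt_sq (hm0 w)]
  have hg : Measurable fun p : (Fin T → ℝ) × ℝ => (p.1, b * m p.1 + p.2) := by fun_prop
  have hg' : Measurable fun p : (Fin (T + 1) → ℝ) × ℝ => (p.1, b * m' p.1 + p.2) := by fun_prop
  have hh := measurable_snoc_response T b a ha
  have hR := measurePreserving_fibrewise L (gaussianReal 0 1) (gaussianReal 0 1)
    (fun w p => (a w / m w * p.1 + √(1 - (a w / m w) ^ 2) * p.2,
      √(1 - (a w / m w) ^ 2) * p.1 - a w / m w * p.2))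
    (by unfold Function.uncurry; fun_prop)
    (fun w => map_gaussianReal_prod_orthogonal _ _ (by
      rw [Real.sq_sqrt (by linarith [hc1 w])]; ring))
  rw [map_prod_eq_map_prodMap _ _ hg, map_prod_eq_map_prodMap _ _ hh,
    Measure.map_map (measurable_simulationStep T m a hm ha) (hg.prodMap measurable_id),
    Measure.map_map hg' (hh.prodMap measurable_id)]
  conv_rhs => rw [← hR.map_eq, Measure.map_map (hg'.comp (hh.prodMap measurable_id)) hR.measurable]
  congr 1
  ext1 q
  obtain ⟨⟨w, x⟩, z⟩ := q
  simp only [simulationStep, Function.comp_apply, Prod.map_apply, id_eq, hmm', ← hsm]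
  refine Prod.ext ?_ ?_
  · dsimp only
    congr 1
    linear_combination b * hcm w
  · dsimp only
    ring

lemma sum_sq_snoc (T : ℕ) (f : (i : Fin (T + 1)) → (Fin i → ℝ) → ℝ) (w : Fin T → ℝ) (y : ℝ) :
    ∑ i : Fin (T + 1), f i (fun j =>
      (Fin.snoc w y : Fin (T + 1) → ℝ) (Fin.castLE i.isLt.le j)) ^ 2 =
    ∑ i : Fin T, f i.castSucc (fun j => w (Fin.castLE i.isLt.le j)) ^ 2 +
      f (Fin.last T) w ^ 2 := by
  rw [Fin.sum_univ_castSucc]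
  congr 1
  · refine Finset.sum_congr rfl fun i _ => ?_
    congr 2
    ext1 j
    exact Fin.snoc_castSucc (α := fun _ => ℝ) y w (Fin.castLE i.isLt.le j)
  · congr 2
    ext1 j
    exact Fin.snoc_castSucc (α := fun _ => ℝ) y w j

/-- From one Gaussian observation of `b * μ₀` and independent noise one can simulate, without
knowing `b`, both the transcript and a Gaussian observation of `b` with the unspent budget. -/
lemma exists_simulation (T : ℕ) (μ₀ : ℝ) (hμ₀ : 0 ≤ μ₀) (f : (i : Fin T) → (Fin i → ℝ) → ℝ)
    (hf : ∀ i : Fin T, Measurable (f i))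
    (hbudget : ∀ w : Fin T → ℝ,
      ∑ i : Fin T, f i (fun j => w (Fin.castLE i.isLt.le j)) ^ 2 ≤ μ₀ ^ 2) :
    ∃ (Ω : Type) (_ : MeasurableSpace Ω) (ρ : Measure Ω) (_ : IsProbabilityMeasure ρ)
      (G : ℝ × Ω → (Fin T → ℝ) × ℝ), Measurable G ∧
      ∀ b : ℝ, ((gaussianReal (b * μ₀) 1).prod ρ).map G =
        ((adaptiveTranscriptLaw T b f).prod (gaussianReal 0 1)).map
          fun p => (p.1, b * remainingBudget T μ₀ f p.1 + p.2) := by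
  induction T with
  | zero =>
    refine ⟨Fin 0 → ℝ, inferInstance, Measure.dirac default, inferInstance, Prod.swap,
      measurable_swap, fun b => ?_⟩
    have hL : adaptiveTranscriptLaw 0 b f = Measure.dirac default := by
      have := isProbabilityMeasure_adaptiveTranscriptLaw 0 b f hf
      rw [adaptiveTranscriptLaw, Measure.pi_of_empty _ default,
        Measure.map_dirac' (measurable_transcriptPrefix 0 b f hf 0 le_rfl)]
      congr 1
      exact Subsingleton.elim _ _
    rw [hL, Measure.prod_swap, Measure.dirac_prod, Measure.dirac_prod, Measure.map_map]
    · rw [← zero_add (b * μ₀), ← gaussianReal_map_const_add, Measure.map_map]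
      · congr 1
        ext1 x
        simp only [remainingBudget, Function.comp_apply, Finset.univ_eq_empty, Finset.sum_empty,
          sub_zero, Real.sqrt_sq hμ₀]
      all_goals fun_prop
    · have := measurable_remainingBudget 0 μ₀ f hf
      fun_prop
    · fun_prop
  | succ T ih =>
    have hb' := fun w : Fin T → ℝ =>
      (sum_sq_snoc T f w 0).symm.trans_le (hbudget (Fin.snoc w 0))
    obtain ⟨Ω, _, ρ, _, G, hG, h⟩ := ih (fun i => f i.castSucc) (fun i => hf _)
      (fun w => (le_add_of_nonneg_right (sq_nonneg _)).trans (hb' w))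
    set m := remainingBudget T μ₀ fun i => f i.castSucc
    have hm : Measurable m := measurable_remainingBudget T μ₀ _ fun i => hf _
    have hstep := measurable_simulationStep T m (f (Fin.last T)) hm (hf _)
    have hG' : Measurable (Prod.map G id : (ℝ × Ω) × ℝ → _) := hG.prodMap measurable_id
    refine ⟨Ω × ℝ, inferInstance, ρ.prod (gaussianReal 0 1), inferInstance,
      simulationStep T m (f (Fin.last T)) ∘ Prod.map G id ∘ MeasurableEquiv.prodAssoc.symm,
      hstep.comp (hG'.comp MeasurableEquiv.prodAssoc.symm.measurable), fun b => ?_⟩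
    have := isProbabilityMeasure_adaptiveTranscriptLaw T b (fun i => f i.castSucc) fun i => hf _
    have hm_sq : ∀ w, m w ^ 2 =
        μ₀ ^ 2 - ∑ i : Fin T, f i.castSucc (fun j => w (Fin.castLE i.isLt.le j)) ^ 2 := fun w =>
      Real.sq_sqrt (sub_nonneg.2 ((le_add_of_nonneg_right (sq_nonneg _)).trans (hb' w)))
    rw [adaptiveTranscriptLaw_succ T b f hf, ← map_simulationStep T _ m (f (Fin.last T))
      (remainingBudget (T + 1) μ₀ f) b hm (hf _) (measurable_remainingBudget _ μ₀ f hf)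
      (fun w => Real.sqrt_nonneg _)
      (fun w => by rw [hm_sq]; linarith [hb' w])
      (fun w y => ?_), ← h b]
    · rw [map_prod_eq_map_prodMap _ _ hG, Measure.map_map hstep hG', ← Function.comp_assoc,
        ← Measure.map_map (hstep.comp hG') MeasurableEquiv.prodAssoc.symm.measurable,
        (measurePreserving_prodAssoc _ _ _).symm.map_eq]
    · rw [hm_sq, remainingBudget, sum_sq_snoc, sub_add_eq_sub_sub]

/-- Fully adaptive composition for Gaussian queries (Theorem 1, concrete form): if the
measurable adaptive budgets `f i` satisfy the budget constraint
`∑ i, f i (w₁, …, wᵢ₋₁)² ≤ μ₀²` along every trajectory `w`, then there is a single Markov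
kernel `κ : ℝ → ℝ^T`, not depending on `b`, such that for every `b ∈ ℝ` the transcript law
`P_b` is the composition of the one-dimensional Gaussian `N(b μ₀, 1)` with `κ`. -/
theorem fully_adaptive_gaussian_composition (T : ℕ) (μ₀ : ℝ) (hμ₀ : 0 < μ₀)
    (f : (i : Fin T) → (Fin i → ℝ) → ℝ)
    (hf : ∀ i : Fin T, Measurable (f i))
    (hbudget : ∀ w : Fin T → ℝ,
      ∑ i : Fin T, f i (fun j => w (Fin.castLE i.isLt.le j)) ^ 2 ≤ μ₀ ^ 2) :
    ∃ κ : Kernel ℝ (Fin T → ℝ), IsMarkovKernel κ ∧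
      ∀ b : ℝ, adaptiveTranscriptLaw T b f =
        (gaussianReal (b * μ₀) 1).bind fun w => κ w := by
  obtain ⟨Ω, _, ρ, _, G, hG, h⟩ := exists_simulation T μ₀ hμ₀.le f hf hbudget
  have hG₁ : Measurable fun p => (G p).1 := measurable_fst.comp hG
  let κ : Kernel ℝ (Fin T → ℝ) := ((Kernel.id : Kernel ℝ ℝ) ×ₖ Kernel.const ℝ ρ).map
    fun p => (G p).1
  refine ⟨κ, Kernel.IsMarkovKernel.map _ hG₁, fun b => ?_⟩
  have := isProbabilityMeasure_adaptiveTranscriptLaw T b f hf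
  have hm := measurable_remainingBudget T μ₀ f hf
  have h₁ := congrArg (Measure.map Prod.fst) (h b)
  rw [Measure.map_map measurable_fst hG, Measure.map_map measurable_fst (by fun_prop)] at h₁
  have h₂ : adaptiveTranscriptLaw T b f =
      ((gaussianReal (b * μ₀) 1).prod ρ).map fun p => (G p).1 := by
    refine Eq.trans ?_ h₁.symm
    exact (measurePreserving_fst (μ := adaptiveTranscriptLaw T b f)
      (ν := gaussianReal 0 1)).map_eq.symm
  rw [h₂]
  ext s hs
  rw [Measure.bind_apply hs κ.measurable.aemeasurable, Measure.map_apply hG₁ hs,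
    Measure.prod_apply (hG₁ hs)]
  refine lintegral_congr fun x => ?_
  rw [Kernel.map_apply' _ hG₁ _ hs, Kernel.prod_apply, Kernel.id_apply, Kernel.const_apply,
    Measure.dirac_prod, Measure.map_apply measurable_prodMk_left (hG₁ hs)]
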